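/- Let p ∈ (1,∞), n ≥ d+1, and let X be a random vector in ℝ^d with compactly supported distribution and span(supp(P_X)) = ℝ^d. If |supp(P_X)| ≥ n, then any grid Γ achieving d_{n,p}(X) has exactly n points. Moreover d_{n,p}(X) = 0 if and only if |supp(P_X)| ≤ n, and the sequence n ↦ d_{n,p}(X) is strictly decreasing as long as it does not vanish (i.e. d_{n+1,p}(X) < d_{n,p}(X) whenever d_{n,p}(X) > 0), and tends to 0 as n → ∞. -/

import Mathlib

open MeasureTheory Set Filter
open scoped ENNReal

/-- `p`-th power of the local dual quantization error `F_p(ξ; Γ)^p` for a finite grid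
`Γ : Finset E`, with the convention `inf ∅ = +∞`. -/
noncomputable def dualQuantFpF {E : Type*} [NormedAddCommGroup E] [NormedSpace ℝ E]
    (p : ℝ) (Γ : Finset E) (ξ : E) : ℝ≥0∞ :=
  ⨅ l : {l : E → ℝ // (∀ y, 0 ≤ l y) ∧ ∑ y ∈ Γ, l y = 1 ∧ ∑ y ∈ Γ, l y • y = ξ},
    ENNReal.ofReal (∑ y ∈ Γ, l.1 y * ‖ξ - y‖ ^ p)

/-- `L^p`-mean dual quantization error `d_p(ν;Γ)` of a distribution `ν` w.r.t. the grid `Γ`. -/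
noncomputable def dualQuantErr {E : Type*} [NormedAddCommGroup E] [NormedSpace ℝ E]
    [MeasurableSpace E] (p : ℝ) (ν : Measure E) (Γ : Finset E) : ℝ≥0∞ :=
  (∫⁻ ξ, dualQuantFpF p Γ ξ ∂ν) ^ (1 / p)

/-- Optimal `L^p`-mean dual quantization error at level `m`: `d_{m,p}(ν)`. -/
noncomputable def dualQuantOpt {E : Type*} [NormedAddCommGroup E] [NormedSpace ℝ E]
    [MeasurableSpace E] (p : ℝ) (m : ℕ) (ν : Measure E) : ℝ≥0∞ :=
  ⨅ Γ : {Γ : Finset E // Γ.card ≤ m}, dualQuantErr p ν Γ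

/-- The support of a measure: points all of whose neighbourhoods have positive mass. -/
def measSupport {E : Type*} [TopologicalSpace E] [MeasurableSpace E] (ν : Measure E) : Set E :=
  {x | ∀ U ∈ nhds x, 0 < ν U}

section PushWeights

variable {α β : Type*} [DecidableEq β]

/-- The image of a family of weights `w` on `s` under the map `g`. -/
def pushWeights (s : Finset α) (g : α → β) (w : α → ℝ) (b : β) : ℝ :=
  ∑ a ∈ s with g a = b, w a

lemma pushWeights_nonneg {s : Finset α} {w : α → ℝ} (hw : ∀ a ∈ s, 0 ≤ w a) (g : α → β) (b : β) :
    0 ≤ pushWeights s g w b :=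
  Finset.sum_nonneg fun a ha => hw a (Finset.mem_filter.1 ha).1

lemma sum_pushWeights_smul {M : Type*} [AddCommGroup M] [Module ℝ M] {s : Finset α} {t : Finset β}
    {g : α → β} (hg : ∀ a ∈ s, g a ∈ t) (w : α → ℝ) (f : β → M) :
    ∑ b ∈ t, pushWeights s g w b • f b = ∑ a ∈ s, w a • f (g a) := by
  rw [← Finset.sum_fiberwise_of_maps_to hg]
  refine Finset.sum_congr rfl fun b _ => ?_
  rw [pushWeights, Finset.sum_smul]
  exact Finset.sum_congr rfl fun a ha => by rw [(Finset.mem_filter.1 ha).2]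

lemma sum_pushWeights {s : Finset α} {t : Finset β}
    {g : α → β} (hg : ∀ a ∈ s, g a ∈ t) (w : α → ℝ) :
    ∑ b ∈ t, pushWeights s g w b = ∑ a ∈ s, w a := by
  simpa using sum_pushWeights_smul hg w (fun _ => (1 : ℝ))

end PushWeights

section Cone

variable {V : Type*} [NormedAddCommGroup V] [NormedSpace ℝ V]

/-- If a family of vectors has no nontrivial conic relation, then the total weight of a conic
combination is controlled by its norm. -/
lemma exists_sum_le_norm_of_forall_ne_zero {ι : Type*} (s : Finset ι) (v : ι → V)
    (h : ∀ c : ι → ℝ, (∀ i ∈ s, 0 ≤ c i) → ∑ i ∈ s, c i • v i = 0 → ∀ i ∈ s, c i = 0) :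
    ∃ C : ℝ, 0 ≤ C ∧ ∀ a : ι → ℝ, (∀ i ∈ s, 0 ≤ a i) →
      ∑ i ∈ s, a i ≤ C * ‖∑ i ∈ s, a i • v i‖ := by
  rcases s.eq_empty_or_nonempty with rfl | hs
  · exact ⟨0, le_rfl, by simp⟩
  have : Nonempty s := hs.to_subtype
  have hcont : Continuous fun c : s → ℝ => ‖∑ i, c i • v i‖ := by fun_prop
  obtain ⟨c, hc, hmin⟩ := (isCompact_stdSimplex ℝ s).exists_isMinOn
    ⟨_, by classical exact single_mem_stdSimplex ℝ (Classical.arbitrary s)⟩ hcont.continuousOn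
  set m := ‖∑ i, c i • v i‖ with hm
  have hmpos : 0 < m := by
    rw [hm, norm_pos_iff]
    intro h0
    classical
    let c' : ι → ℝ := fun i => if hi : i ∈ s then c ⟨i, hi⟩ else 0
    have hc' : ∀ i : s, c' i = c i := fun i => by simp [c']
    have hz := h c' (fun i hi => by simpa [c', hi] using hc.1 ⟨i, hi⟩) (by
      rw [← Finset.sum_coe_sort]; simpa only [hc'] using h0)
    have h1 := hc.2
    rw [Finset.sum_eq_zero fun i _ => by rw [← hc', hz i i.2]] at h1
    exact zero_ne_one h1
  refine ⟨m⁻¹, by positivity, fun a ha => ?_⟩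
  rcases (Finset.sum_nonneg ha).eq_or_lt with h0 | hpos
  · rw [← h0]; positivity
  set S := ∑ i ∈ s, a i with hS
  have hle : m ≤ ‖∑ i : s, (S⁻¹ * a i) • v i‖ := by
    refine hmin (a := fun i : s => S⁻¹ * a i) ⟨fun i => mul_nonneg (by positivity) (ha i i.2), ?_⟩
    rw [← Finset.mul_sum, Finset.sum_coe_sort s a, ← hS, inv_mul_cancel₀ hpos.ne']
  simp only [mul_smul] at hle
  rw [← Finset.smul_sum, Finset.sum_coe_sort s (fun i => a i • v i), norm_smul, norm_inv,
    Real.norm_of_nonneg hpos.le] at hle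
  rw [inv_mul_eq_div] at hle ⊢
  rw [le_div_iff₀ hmpos]
  rwa [le_div_iff₀ hpos, mul_comm] at hle

/-- Every conic combination of finitely many vectors can be rewritten with a total weight bounded
by a multiple of its norm. -/
lemma exists_conic_combination_sum_le {ι : Type*} (s : Finset ι) (v : ι → V) :
    ∃ C : ℝ, 0 ≤ C ∧ ∀ a : ι → ℝ, (∀ i ∈ s, 0 ≤ a i) → ∃ b : ι → ℝ, (∀ i ∈ s, 0 ≤ b i) ∧
      ∑ i ∈ s, b i • v i = ∑ i ∈ s, a i • v i ∧ ∑ i ∈ s, b i ≤ C * ‖∑ i ∈ s, a i • v i‖ := by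
  classical
  induction s using Finset.strongInduction with
  | H s ih =>
  by_cases h : ∀ c : ι → ℝ, (∀ i ∈ s, 0 ≤ c i) → ∑ i ∈ s, c i • v i = 0 → ∀ i ∈ s, c i = 0
  · obtain ⟨C, hC, hb⟩ := exists_sum_le_norm_of_forall_ne_zero s v h
    exact ⟨C, hC, fun a ha => ⟨a, ha, rfl, hb a ha⟩⟩
  push Not at h
  obtain ⟨c, hc, hc0, j, hj, hcj⟩ := h
  have ih' : ∀ i : s, ∃ C : ℝ, 0 ≤ C ∧ ∀ a : ι → ℝ, (∀ k ∈ s.erase i, 0 ≤ a k) → ∃ b : ι → ℝ,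
      (∀ k ∈ s.erase i, 0 ≤ b k) ∧ ∑ k ∈ s.erase i, b k • v k = ∑ k ∈ s.erase i, a k • v k ∧
      ∑ k ∈ s.erase i, b k ≤ C * ‖∑ k ∈ s.erase i, a k • v k‖ :=
    fun i => ih _ (Finset.erase_ssubset i.2)
  choose C hC hCb using ih'
  refine ⟨∑ i, C i, Finset.sum_nonneg fun i _ => hC i, fun a ha => ?_⟩
  obtain ⟨i, hi, hmin⟩ := (s.filter fun i => 0 < c i).exists_min_image (fun i => a i / c i)
    ⟨j, Finset.mem_filter.2 ⟨hj, (hc j hj).lt_of_ne' hcj⟩⟩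
  obtain ⟨his, hci⟩ := Finset.mem_filter.1 hi
  set r := a i / c i
  have hr : 0 ≤ r := div_nonneg (ha i his) hci.le
  have ha' : ∀ k ∈ s, 0 ≤ a k - r * c k := fun k hk => by
    rcases (hc k hk).eq_or_lt with h0 | hpos
    · simpa [← h0] using ha k hk
    · exact sub_nonneg.2 ((le_div_iff₀ hpos).1 (hmin k (Finset.mem_filter.2 ⟨hk, hpos⟩)))
  have hai : a i - r * c i = 0 := by simp [r, hci.ne']
  have hsum : ∑ k ∈ s.erase i, (a k - r * c k) • v k = ∑ k ∈ s, a k • v k := by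
    have := Finset.add_sum_erase s (fun k => (a k - r * c k) • v k) his
    rw [hai, zero_smul, zero_add] at this
    rw [this]
    simp only [sub_smul, mul_smul, Finset.sum_sub_distrib, ← Finset.smul_sum, hc0, smul_zero,
      sub_zero]
  obtain ⟨b, hb, hbs, hbC⟩ := hCb ⟨i, his⟩ (fun k => a k - r * c k)
    fun k hk => ha' k (Finset.mem_of_mem_erase hk)
  simp only [hsum] at hbs hbC
  refine ⟨fun k => if k = i then 0 else b k, fun k hk => ?_, ?_, ?_⟩
  · by_cases hki : k = i
    · simp [hki]
    · simpa [hki] using hb k (Finset.mem_erase.2 ⟨hki, hk⟩)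
  · rw [← hbs, ← Finset.add_sum_erase s _ his]
    simp only [if_true, zero_smul, zero_add]
    exact Finset.sum_congr rfl fun k hk => by rw [if_neg (Finset.ne_of_mem_erase hk)]
  · rw [← Finset.add_sum_erase s _ his]
    simp only [if_true, zero_add]
    rw [Finset.sum_congr rfl fun k hk => if_neg (Finset.ne_of_mem_erase hk)]
    refine hbC.trans (mul_le_mul_of_nonneg_right ?_ (norm_nonneg _))
    exact Finset.single_le_sum (f := C) (fun i _ => hC i) (Finset.mem_univ _)

end Cone

lemma exists_pos_forall_lt_norm_sub_rpow {E : Type*} [NormedAddCommGroup E] {Γ : Finset E} {ξ : E}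
    (p : ℝ) (h : ξ ∉ Γ) :
    ∃ c : ℝ, 0 < c ∧ ∀ y ∈ Γ, c < ‖ξ - y‖ ^ p := by
  have hc : ∀ᶠ c : ℝ in nhdsWithin 0 (Ioi 0), ∀ y ∈ Γ, c < ‖ξ - y‖ ^ p :=
    (Filter.eventually_all_finset Γ).2 fun y hy => nhdsWithin_le_nhds <| eventually_lt_nhds <|
      Real.rpow_pos_of_pos (norm_pos_iff.2 (sub_ne_zero.2 (by rintro rfl; exact h hy))) p
  obtain ⟨c, hc, hc0⟩ := (hc.and self_mem_nhdsWithin).exists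
  exact ⟨c, hc0, hc⟩

section LocalError

variable {E : Type*} [NormedAddCommGroup E] [NormedSpace ℝ E] {p : ℝ} {Γ : Finset E} {ξ : E}

lemma dualQuantFpF_le_of_mem {ι : Type*} (s : Finset ι) (x : ι → E) (hx : ∀ i ∈ s, x i ∈ Γ)
    (w : ι → ℝ) (hw : ∀ i ∈ s, 0 ≤ w i) (hw1 : ∑ i ∈ s, w i = 1) (hξ : ∑ i ∈ s, w i • x i = ξ) :
    dualQuantFpF p Γ ξ ≤ ENNReal.ofReal (∑ i ∈ s, w i * ‖ξ - x i‖ ^ p) := by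
  classical
  refine (iInf_le _ ⟨pushWeights s x w, pushWeights_nonneg hw x,
    (sum_pushWeights hx w).trans hw1, (sum_pushWeights_smul hx w id).trans hξ⟩).trans_eq ?_
  exact congrArg ENNReal.ofReal (sum_pushWeights_smul hx w fun y => ‖ξ - y‖ ^ p)

lemma dualQuantFpF_mono {Γ' : Finset E} (h : Γ ⊆ Γ') (ξ : E) :
    dualQuantFpF p Γ' ξ ≤ dualQuantFpF p Γ ξ :=
  le_iInf fun l => dualQuantFpF_le_of_mem Γ id (fun _ hi => h hi) l.1 (fun i _ => l.2.1 i)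
    l.2.2.1 l.2.2.2

lemma dualQuantFpF_of_mem (hp : p ≠ 0) (h : ξ ∈ Γ) : dualQuantFpF p Γ ξ = 0 := by
  have := dualQuantFpF_le_of_mem (p := p) (ξ := ξ) (Γ := Γ) {ξ} id (by simpa) (fun _ => 1)
    (by simp) (by simp) (by simp)
  simpa [hp] using this

lemma ofReal_le_dualQuantFpF {c : ℝ} (h : ∀ y ∈ Γ, c ≤ ‖ξ - y‖ ^ p) :
    ENNReal.ofReal c ≤ dualQuantFpF p Γ ξ := by
  refine le_iInf fun l => ENNReal.ofReal_le_ofReal ?_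
  calc c = ∑ y ∈ Γ, l.1 y * c := by rw [← Finset.sum_mul, l.2.2.1, one_mul]
    _ ≤ _ := Finset.sum_le_sum fun y hy => mul_le_mul_of_nonneg_left (h y hy) (l.2.1 y)

lemma dualQuantFpF_le_of_mem_convexHull {s : Finset E} (hs : s ⊆ Γ)
    (hξ : ξ ∈ convexHull ℝ (s : Set E)) {c : ℝ} (hc : ∀ y ∈ s, ‖ξ - y‖ ^ p ≤ c) :
    dualQuantFpF p Γ ξ ≤ ENNReal.ofReal c := by
  obtain ⟨w, hw, hw1, hwξ⟩ := Finset.mem_convexHull'.1 hξ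
  refine (dualQuantFpF_le_of_mem s id (fun i hi => hs hi) w hw hw1 hwξ).trans
    (ENNReal.ofReal_le_ofReal ?_)
  calc ∑ y ∈ s, w y * ‖ξ - y‖ ^ p ≤ ∑ y ∈ s, w y * c :=
        Finset.sum_le_sum fun y hy => mul_le_mul_of_nonneg_left (hc y hy) (hw y hy)
    _ = c := by rw [← Finset.sum_mul, hw1, one_mul]

lemma dualQuantFpF_eq_zero_iff (hp : p ≠ 0) : dualQuantFpF p Γ ξ = 0 ↔ ξ ∈ Γ := by
  refine ⟨fun h => ?_, dualQuantFpF_of_mem hp⟩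
  by_contra hξ
  obtain ⟨c, hc0, hc⟩ := exists_pos_forall_lt_norm_sub_rpow p hξ
  have := ofReal_le_dualQuantFpF fun y hy => (hc y hy).le
  rw [h, nonpos_iff_eq_zero, ENNReal.ofReal_eq_zero] at this
  exact this.not_gt hc0

/-- Adding `ξ₀` to the grid strictly decreases the local error near `ξ₀`. -/
lemma eventually_dualQuantFpF_insert_lt [DecidableEq E] (hp : 0 < p) {ξ₀ : E} (h₀ : ξ₀ ∉ Γ) :
    ∀ᶠ ξ in nhds ξ₀, dualQuantFpF p Γ ξ ≠ ∞ →
      dualQuantFpF p (insert ξ₀ Γ) ξ < dualQuantFpF p Γ ξ := by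
  obtain ⟨c, hc0, hc⟩ := exists_pos_forall_lt_norm_sub_rpow p h₀
  have hcont : ∀ y : E, Continuous fun ξ : E => ‖ξ - y‖ ^ p := fun y =>
    (continuous_id.sub continuous_const).norm.rpow_const fun _ => Or.inr hp.le
  have hlow : ∀ᶠ ξ in nhds ξ₀, ∀ y ∈ Γ, c < ‖ξ - y‖ ^ p :=
    (Filter.eventually_all_finset Γ).2 fun y hy =>
      (hcont y).continuousAt.eventually (lt_mem_nhds (hc y hy))
  obtain ⟨C, hC, hCb⟩ := exists_conic_combination_sum_le Γ fun y => y - ξ₀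
  have hsmall : ∀ᶠ ξ in nhds ξ₀, C * ‖ξ - ξ₀‖ < 1 := by
    have : Continuous fun ξ : E => C * ‖ξ - ξ₀‖ := by fun_prop
    exact this.continuousAt.eventually (gt_mem_nhds (by simp))
  have hup : ∀ᶠ ξ in nhds ξ₀,
      ‖ξ - ξ₀‖ ^ p + (C * ‖ξ - ξ₀‖) * ∑ y ∈ Γ, ‖ξ - y‖ ^ p < c := by
    have : Continuous fun ξ : E =>
        ‖ξ - ξ₀‖ ^ p + (C * ‖ξ - ξ₀‖) * ∑ y ∈ Γ, ‖ξ - y‖ ^ p :=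
      (hcont _).add (Continuous.mul (by fun_prop) (continuous_finsetSum _ fun y _ => hcont y))
    exact this.continuousAt.eventually (gt_mem_nhds (by simpa [hp.ne'] using hc0))
  filter_upwards [hlow, hsmall, hup] with ξ hlow hsmall hup hfin
  refine lt_of_lt_of_le ?_ (ofReal_le_dualQuantFpF fun y hy => (hlow y hy).le)
  obtain ⟨l, -⟩ := iInf_lt_iff.1 (lt_top_iff_ne_top.2 hfin)
  have hlsum : ∑ y ∈ Γ, l.1 y • (y - ξ₀) = ξ - ξ₀ := by
    simp only [smul_sub, Finset.sum_sub_distrib, ← Finset.sum_smul, l.2.2.1, l.2.2.2, one_smul]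
  obtain ⟨b, hb, hbs, hbC⟩ := hCb l.1 fun i _ => l.2.1 i
  rw [hlsum] at hbs hbC
  have hne : ∀ y ∈ Γ, y ≠ ξ₀ := fun y hy h => h₀ (h ▸ hy)
  have hS : 0 ≤ ∑ y ∈ Γ, b y := Finset.sum_nonneg hb
  let w : E → ℝ := fun y => if y = ξ₀ then 1 - ∑ y ∈ Γ, b y else b y
  have hw₀ : w ξ₀ = 1 - ∑ y ∈ Γ, b y := if_pos rfl
  have hw : ∀ y ∈ Γ, w y = b y := fun y hy => if_neg (hne y hy)
  have hwx : ∑ y ∈ Γ, w y • id y = ∑ y ∈ Γ, b y • y :=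
    Finset.sum_congr rfl fun y hy => by rw [hw y hy, id]
  have hwn : ∑ y ∈ Γ, w y * ‖ξ - id y‖ ^ p = ∑ y ∈ Γ, b y * ‖ξ - y‖ ^ p :=
    Finset.sum_congr rfl fun y hy => by rw [hw y hy, id]
  refine (dualQuantFpF_le_of_mem (insert ξ₀ Γ) id (fun _ h => h) w ?_ ?_ ?_).trans_lt
    ((ENNReal.ofReal_lt_ofReal_iff hc0).2 (lt_of_le_of_lt ?_ hup))
  · refine Finset.forall_mem_insert _ _ _ |>.2 ⟨by rw [hw₀]; linarith, fun y hy => ?_⟩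
    rw [hw y hy]; exact hb y hy
  · rw [Finset.sum_insert h₀, hw₀, Finset.sum_congr rfl hw, sub_add_cancel]
  · rw [Finset.sum_insert h₀, hw₀, hwx]
    simp only [smul_sub, Finset.sum_sub_distrib, ← Finset.sum_smul] at hbs
    simp only [id, sub_smul, one_smul]
    rw [sub_add_eq_add_sub, add_sub_assoc, hbs, add_sub_cancel]
  · rw [Finset.sum_insert h₀, hw₀, hwn]
    refine add_le_add ?_ ?_
    · exact mul_le_of_le_one_left (by positivity) (by linarith)
    · calc ∑ y ∈ Γ, b y * ‖ξ - y‖ ^ p ≤ ∑ y ∈ Γ, b y * ∑ z ∈ Γ, ‖ξ - z‖ ^ p := by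
            refine Finset.sum_le_sum fun y hy => mul_le_mul_of_nonneg_left ?_ (hb y hy)
            exact Finset.single_le_sum (f := fun z => ‖ξ - z‖ ^ p)
              (fun z _ => by positivity) hy
        _ ≤ _ := by
            rw [← Finset.sum_mul]
            exact mul_le_mul_of_nonneg_right hbC (Finset.sum_nonneg fun z _ => by positivity)

lemma tendsto_zero_of_mul_rpow_le {a N : ℕ → ℝ} {C : ℝ} (hp : 1 < p) (ha : ∀ k, 0 ≤ a k)
    (hN : Tendsto N atTop atTop) (h : ∀ k, a k * N k ^ p ≤ C) :
    Tendsto a atTop (nhds 0) ∧ Tendsto (fun k => a k * N k) atTop (nhds 0) := by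
  have hev : ∀ᶠ k in atTop, a k * N k ≤ C * N k ^ (-(p - 1)) := by
    filter_upwards [hN.eventually_ge_atTop 1] with k hk
    have hk0 : 0 < N k := by linarith
    calc a k * N k = a k * N k ^ p * N k ^ (-(p - 1)) := by
          rw [mul_assoc, ← Real.rpow_add hk0]; simp
      _ ≤ _ := by gcongr; exact h k
  have hlim : Tendsto (fun k => C * N k ^ (-(p - 1))) atTop (nhds 0) := by
    simpa using ((tendsto_rpow_neg_atTop (sub_pos.2 hp)).comp hN).const_mul C
  have hmul : Tendsto (fun k => a k * N k) atTop (nhds 0) := by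
    refine squeeze_zero' ?_ hev hlim
    filter_upwards [hN.eventually_ge_atTop 1] with k hk
    exact mul_nonneg (ha k) (by linarith)
  refine ⟨squeeze_zero' (Eventually.of_forall ha) ?_ hmul, hmul⟩
  filter_upwards [hN.eventually_ge_atTop 1] with k hk
  exact le_mul_of_one_le_right (ha k) hk

/-- Lower semicontinuity of the local error along grids whose points either converge or escape
to infinity; the escaping points disappear from the limit grid because `1 < p`. -/
lemma dualQuantFpF_image_le_of_forall_lt {ι : Type*} [Fintype ι] [DecidableEq E] (hp : 1 < p)
    {x : ℕ → ι → E} {I : Finset ι} {y : ι → E}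
    (hI : ∀ i ∈ I, Tendsto (fun k => x k i) atTop (nhds (y i)))
    (hI' : ∀ i ∉ I, Tendsto (fun k => ‖x k i‖) atTop atTop)
    {Γ : ℕ → Finset E} (hΓ : ∀ k, ∀ z ∈ Γ k, ∃ i, x k i = z)
    {ξs : ℕ → E} (hξ : Tendsto ξs atTop (nhds ξ)) {c : ℝ≥0∞}
    (hc : ∀ k, dualQuantFpF p (Γ k) (ξs k) < c) : dualQuantFpF p (I.image y) ξ ≤ c := by
  classical
  rcases eq_or_ne c ∞ with rfl | hctop
  · exact le_top
  have hrep : ∀ k, ∃ w ∈ stdSimplex ℝ ι, ∑ i, w i • x k i = ξs k ∧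
      ∑ i, w i * ‖ξs k - x k i‖ ^ p ≤ c.toReal := fun k => by
    obtain ⟨l, hl⟩ := iInf_lt_iff.1 (hc k)
    have : Nonempty ι := by
      by_contra hι
      have : Γ k = ∅ := Finset.eq_empty_of_forall_notMem fun z hz => hι ⟨(hΓ k z hz).choose⟩
      simpa [this] using l.2.2.1
    choose! g hg using hΓ k
    have hmaps : ∀ z ∈ Γ k, g z ∈ Finset.univ := fun _ _ => Finset.mem_univ _
    refine ⟨pushWeights (Γ k) g l.1, ⟨pushWeights_nonneg (fun z _ => l.2.1 z) g, ?_⟩, ?_, ?_⟩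
    · rw [sum_pushWeights hmaps, l.2.2.1]
    · rw [sum_pushWeights_smul hmaps l.1 (x k)]
      exact (Finset.sum_congr rfl fun z hz => by rw [hg z hz]).trans l.2.2.2
    · have := sum_pushWeights_smul hmaps l.1 fun i => ‖ξs k - x k i‖ ^ p
      simp only [smul_eq_mul] at this
      rw [this, Finset.sum_congr rfl fun z hz => by rw [hg z hz]]
      exact (ENNReal.ofReal_le_iff_le_toReal hctop).1 hl.le
  choose w hw hwξ hwc using hrep
  obtain ⟨v, hv, φ, hφ, hlim⟩ := (isCompact_stdSimplex ℝ ι).tendsto_subseq hw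
  have hlim' : ∀ i, Tendsto (fun k => w (φ k) i) atTop (nhds (v i)) := fun i =>
    (continuous_apply i).continuousAt.tendsto.comp hlim
  have hξφ : Tendsto (fun k => ξs (φ k)) atTop (nhds ξ) := hξ.comp hφ.tendsto_atTop
  have hterm : ∀ k i, w k i * ‖ξs k - x k i‖ ^ p ≤ c.toReal := fun k i =>
    (Finset.single_le_sum (f := fun i => w k i * ‖ξs k - x k i‖ ^ p)
      (fun j _ => mul_nonneg ((hw k).1 j) (by positivity)) (Finset.mem_univ i)).trans (hwc k)
  have hesc : ∀ i ∉ I, v i = 0 ∧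
      Tendsto (fun k => w (φ k) i • x (φ k) i) atTop (nhds 0) := fun i hi => by
    have hN : Tendsto (fun k => ‖ξs (φ k) - x (φ k) i‖) atTop atTop := by
      have h1 : Tendsto (fun k => ‖x (φ k) i‖ + -‖ξs (φ k)‖) atTop atTop :=
        ((hI' i hi).comp hφ.tendsto_atTop).atTop_add hξφ.norm.neg
      refine tendsto_atTop_mono (fun k => ?_) h1
      rw [← sub_eq_add_neg, norm_sub_rev]
      exact norm_sub_norm_le _ _
    obtain ⟨h0, h1⟩ := tendsto_zero_of_mul_rpow_le hp (fun k => (hw (φ k)).1 i) hN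
      fun k => hterm (φ k) i
    refine ⟨tendsto_nhds_unique (hlim' i) h0, ?_⟩
    have h2 : Tendsto (fun k => w (φ k) i • (ξs (φ k) - x (φ k) i)) atTop (nhds 0) := by
      refine squeeze_zero_norm (fun k => ?_) h1
      rw [norm_smul, Real.norm_of_nonneg ((hw (φ k)).1 i)]
    simpa [smul_sub] using (h0.smul hξφ).sub h2
  have hsum : ∑ i ∈ I, v i = 1 := by
    rw [← hv.2]
    exact Finset.sum_subset I.subset_univ fun i _ hi => (hesc i hi).1
  have hbar : ∑ i ∈ I, v i • y i = ξ := by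
    refine tendsto_nhds_unique (f := fun k => ∑ i, w (φ k) i • x (φ k) i) (l := atTop) ?_
      (by simpa only [hwξ] using hξφ)
    have : Tendsto (fun k => ∑ i, w (φ k) i • x (φ k) i) atTop
        (nhds (∑ i, if i ∈ I then v i • y i else 0)) := by
      refine tendsto_finsetSum _ fun i _ => ?_
      by_cases hi : i ∈ I
      · simpa only [hi, if_true] using! (hlim' i).smul ((hI i hi).comp hφ.tendsto_atTop)
      · simpa only [hi, if_false] using (hesc i hi).2
    simpa using this
  refine (dualQuantFpF_le_of_mem I y (fun i hi => Finset.mem_image_of_mem y hi) v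
    (fun i _ => hv.1 i) hsum hbar).trans ((ENNReal.ofReal_le_iff_le_toReal hctop).2 ?_)
  refine le_of_tendsto' (f := fun k => ∑ i ∈ I, w (φ k) i * ‖ξs (φ k) - x (φ k) i‖ ^ p)
    (x := atTop) ?_ fun k => ?_
  · refine tendsto_finsetSum _ fun i hi => (hlim' i).mul ?_
    exact (hξφ.sub ((hI i hi).comp hφ.tendsto_atTop)).norm.rpow_const (Or.inr (by linarith))
  · refine (Finset.sum_le_sum_of_subset_of_nonneg I.subset_univ fun i _ _ => ?_).trans (hwc (φ k))
    exact mul_nonneg ((hw (φ k)).1 i) (by positivity)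

lemma lowerSemicontinuous_dualQuantFpF (hp : 1 < p) (Γ : Finset E) :
    LowerSemicontinuous (dualQuantFpF p Γ) := by
  classical
  refine lowerSemicontinuous_iff_isClosed_preimage.2 fun c => IsSeqClosed.isClosed ?_
  intro ξs ξ hξs hξ
  refine le_of_forall_gt (α := ℝ≥0∞) (a := c) fun c' hc' => ?_
  obtain ⟨c'', h1, h2⟩ := exists_between hc'
  refine lt_of_le_of_lt ?_ h2
  have := dualQuantFpF_image_le_of_forall_lt (x := fun _ (i : Γ) => (i : E)) (I := Finset.univ)
    (y := fun i => (i : E)) (Γ := fun _ => Γ) (c := c'') hp (fun i _ => tendsto_const_nhds)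
    (by simp) (by simp) hξ (fun k => (show _ ≤ c from hξs k).trans_lt h1)
  rwa [Finset.univ_eq_attach, Finset.attach_image_val] at this

lemma measurable_dualQuantFpF [MeasurableSpace E] [BorelSpace E] (hp : 1 < p) (Γ : Finset E) :
    Measurable (dualQuantFpF p Γ) :=
  measurable_of_Iic fun c =>
    ((lowerSemicontinuous_dualQuantFpF hp Γ).isClosed_preimage c).measurableSet

end LocalError

section Grid

variable {E : Type*} [NormedAddCommGroup E] [NormedSpace ℝ E] [FiniteDimensional ℝ E] {p : ℝ}

open scoped Pointwise in
/-- A bounded set is contained in a simplex, on which the local error is bounded. -/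
lemma exists_simplex_dualQuantFpF_le (hp : 0 ≤ p) {K : Set E} (hK : Bornology.IsBounded K) :
    ∃ Γ : Finset E, Γ.card ≤ Module.finrank ℝ E + 1 ∧
      ∃ c : ℝ, ∀ ξ ∈ K, dualQuantFpF p Γ ξ ≤ ENNReal.ofReal c := by
  classical
  obtain ⟨b, hb, -⟩ := exists_mem_interior_convexHull_affineBasis (x := (0 : E)) univ_mem
  obtain ⟨r, hr, hball⟩ := Metric.mem_nhds_iff.1 (mem_interior_iff_mem_nhds.1 hb)
  obtain ⟨R, hR, hKR⟩ := hK.exists_pos_norm_lt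
  set t := R / r
  have ht : 0 < t := by positivity
  refine ⟨Finset.univ.image fun i => t • b i, Finset.card_image_le.trans (by simp),
    (R + ∑ i, ‖t • b i‖) ^ p, fun ξ hξ => ?_⟩
  refine dualQuantFpF_le_of_mem_convexHull subset_rfl ?_ ?_
  · have : ((Finset.univ.image fun i => t • b i : Finset E) : Set E) = t • range b := by
      ext z; simp [mem_smul_set]
    rw [this, convexHull_smul]
    refine ⟨t⁻¹ • ξ, hball ?_, smul_inv_smul₀ ht.ne' ξ⟩
    rw [mem_ball_zero_iff, norm_smul, norm_inv, Real.norm_of_nonneg ht.le, inv_mul_lt_iff₀ ht]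
    simpa [t, hr.ne'] using hKR ξ hξ
  · intro y hy
    obtain ⟨i, -, rfl⟩ := Finset.mem_image.1 hy
    refine Real.rpow_le_rpow (norm_nonneg _) ((norm_sub_le _ _).trans ?_) hp
    exact add_le_add (hKR ξ hξ).le
      (Finset.single_le_sum (f := fun i => ‖t • b i‖) (fun _ _ => norm_nonneg _)
        (Finset.mem_univ i))

/-- On a compact set, the local error can be made uniformly small. -/
lemma exists_finset_dualQuantFpF_le (hp : 0 ≤ p) {K : Set E} (hK : IsCompact K) {ε : ℝ}
    (hε : 0 < ε) :
    ∃ Γ : Finset E, ∀ ξ ∈ K, dualQuantFpF p Γ ξ ≤ ENNReal.ofReal (ε ^ p) := by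
  classical
  choose b hb hbs using fun x : E =>
    exists_mem_interior_convexHull_affineBasis (Metric.ball_mem_nhds x (half_pos hε))
  obtain ⟨u, -, hu⟩ := hK.elim_nhds_subcover (fun x => interior (convexHull ℝ (range (b x))))
    fun x _ => isOpen_interior.mem_nhds (hb x)
  refine ⟨u.biUnion fun x => Finset.univ.image (b x), fun ξ hξ => ?_⟩
  obtain ⟨x, hx, hξx⟩ := mem_iUnion₂.1 (hu hξ)
  replace hξx := interior_subset hξx
  refine dualQuantFpF_le_of_mem_convexHull
    (Finset.subset_biUnion_of_mem (fun x => Finset.univ.image (b x)) hx) (by simpa using hξx) ?_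
  intro y hy
  obtain ⟨i, -, rfl⟩ := Finset.mem_image.1 hy
  refine Real.rpow_le_rpow (norm_nonneg _) ?_ hp
  have h1 := Metric.mem_ball.1 (hbs x hξx)
  have h2 := Metric.mem_ball.1 (hbs x (subset_convexHull ℝ _ (mem_range_self i)))
  rw [← dist_eq_norm]
  linarith [dist_triangle_right ξ (b x i) x]

end Grid

lemma exists_subseq_tendsto_or_norm_atTop {E : Type*} [NormedAddCommGroup E] [ProperSpace E]
    {ι : Type*} (s : Finset ι) (x : ℕ → ι → E) : ∃ φ : ℕ → ℕ, StrictMono φ ∧ ∀ i ∈ s,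
      (∃ y, Tendsto (fun k => x (φ k) i) atTop (nhds y)) ∨
        Tendsto (fun k => ‖x (φ k) i‖) atTop atTop := by
  classical
  induction s using Finset.induction_on with
  | empty => exact ⟨id, strictMono_id, by simp⟩
  | insert i s _ ih =>
    obtain ⟨φ, hφ, h⟩ := ih
    by_cases hi : Tendsto (fun k => ‖x (φ k) i‖) atTop atTop
    · exact ⟨φ, hφ, Finset.forall_mem_insert _ _ _ |>.2 ⟨Or.inr hi, h⟩⟩
    · simp only [tendsto_atTop, not_forall] at hi
      obtain ⟨R, hR⟩ := hi
      obtain ⟨y, -, ψ, hψ, hy⟩ := tendsto_subseq_of_frequently_bounded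
        (x := fun k => x (φ k) i) (Metric.isBounded_ball (x := (0 : E)) (r := R))
        ((not_eventually.1 hR).mono fun k hk => by simpa using hk)
      refine ⟨φ ∘ ψ, hφ.comp hψ, Finset.forall_mem_insert _ _ _ |>.2 ⟨Or.inl ⟨y, hy⟩, ?_⟩⟩
      exact fun j hj => (h j hj).imp (fun ⟨z, hz⟩ => ⟨z, hz.comp hψ.tendsto_atTop⟩)
        fun hz => hz.comp hψ.tendsto_atTop

lemma Finset.exists_fin_enumeration {α : Type*} [Nonempty α] {s : Finset α} {m : ℕ}
    (hs : s.card ≤ m) : ∃ x : Fin m → α, ∀ z ∈ s, ∃ i, x i = z := by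
  refine ⟨fun i => if h : (i : ℕ) < s.card then s.equivFin.symm ⟨i, h⟩
    else Classical.arbitrary α, fun z hz => ?_⟩
  exact ⟨⟨s.equivFin ⟨z, hz⟩, (s.equivFin ⟨z, hz⟩).2.trans_le hs⟩, by simp⟩

lemma measSupport_eq_support {E : Type*} [TopologicalSpace E] [MeasurableSpace E]
    (ν : Measure E) : measSupport ν = ν.support := by
  ext x
  exact (Measure.mem_support_iff_forall x).symm

section Optimal

variable {E : Type*} [NormedAddCommGroup E] [NormedSpace ℝ E] [MeasurableSpace E]
  {p : ℝ} {ν : Measure E} {Γ : Finset E}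

lemma dualQuantOpt_le {m : ℕ} (h : Γ.card ≤ m) : dualQuantOpt p m ν ≤ dualQuantErr p ν Γ :=
  iInf_le (fun Γ : {Γ : Finset E // Γ.card ≤ m} => dualQuantErr p ν Γ) ⟨Γ, h⟩

lemma dualQuantOpt_anti : Antitone fun m => dualQuantOpt p m ν := fun _ _ hmn =>
  le_iInf fun Γ => dualQuantOpt_le (Γ.2.trans hmn)

lemma dualQuantErr_le_of_forall_measSupport [SecondCountableTopology E] [IsProbabilityMeasure ν]
    (hp : 0 ≤ p) {c : ℝ≥0∞} (h : ∀ ξ ∈ measSupport ν, dualQuantFpF p Γ ξ ≤ c) :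
    dualQuantErr p ν Γ ≤ c ^ (1 / p) := by
  refine ENNReal.rpow_le_rpow ?_ (by positivity)
  calc ∫⁻ ξ, dualQuantFpF p Γ ξ ∂ν ≤ ∫⁻ _, c ∂ν := by
        refine lintegral_mono_ae ?_
        filter_upwards [Measure.support_mem_ae] with ξ hξ
        exact h ξ (by rwa [measSupport_eq_support])
    _ = c := by simp

lemma dualQuantOpt_ne_top [FiniteDimensional ℝ E] [IsProbabilityMeasure ν] (hp : 1 < p)
    (hν : IsCompact (measSupport ν)) {m : ℕ} (hm : Module.finrank ℝ E + 1 ≤ m) : dualQuantOpt p m ν ≠ ∞ := by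
  have : ProperSpace E := FiniteDimensional.proper_real E
  have hp0 : 0 ≤ p := by linarith
  obtain ⟨Γ, hΓ, c, hc⟩ := exists_simplex_dualQuantFpF_le hp0 hν.isBounded
  refine ne_top_of_le_ne_top ?_ ((dualQuantOpt_le (hΓ.trans hm)).trans
    (dualQuantErr_le_of_forall_measSupport hp0 hc))
  exact ENNReal.rpow_ne_top_of_nonneg (by positivity) ENNReal.ofReal_ne_top

lemma tendsto_dualQuantOpt [FiniteDimensional ℝ E] [IsProbabilityMeasure ν] (hp : 1 < p)
    (hν : IsCompact (measSupport ν)) :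
    Tendsto (fun m => dualQuantOpt p m ν) atTop (nhds 0) := by
  have : ProperSpace E := FiniteDimensional.proper_real E
  have hp0 : 0 < p := by linarith
  refine ENNReal.tendsto_atTop_zero.2 fun ε hε => ?_
  obtain ⟨δ, hδ0, hδε⟩ := ENNReal.lt_iff_exists_nnreal_btwn.1 hε
  obtain ⟨Γ, hΓ⟩ := exists_finset_dualQuantFpF_le hp0.le hν
    (NNReal.coe_pos.2 (ENNReal.coe_pos.1 hδ0))
  refine ⟨Γ.card, fun m hm => (dualQuantOpt_le hm).trans
    ((dualQuantErr_le_of_forall_measSupport hp0.le hΓ).trans (le_of_eq_of_le ?_ hδε.le))⟩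
  rw [← ENNReal.ofReal_rpow_of_nonneg δ.coe_nonneg hp0.le, one_div, ENNReal.rpow_rpow_inv hp0.ne',
    ENNReal.ofReal_coe_nnreal]

variable [BorelSpace E]

/-- Optimal grids exist at every level. -/
lemma exists_dualQuantErr_le_dualQuantOpt [ProperSpace E] (hp : 1 < p) (m : ℕ) (ν : Measure E) :
    ∃ Γ : Finset E, Γ.card ≤ m ∧ dualQuantErr p ν Γ ≤ dualQuantOpt p m ν := by
  classical
  have hp0 : p ≠ 0 := by linarith
  have : Nonempty {Γ : Finset E // Γ.card ≤ m} := ⟨⟨∅, by simp⟩⟩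
  obtain ⟨u, -, hu, hmem⟩ := exists_seq_tendsto_sInf
    (range_nonempty fun Γ : {Γ : Finset E // Γ.card ≤ m} => dualQuantErr p ν Γ)
    (OrderBot.bddBelow _)
  choose Γ hΓ using hmem
  choose x hx using fun k => Finset.exists_fin_enumeration (Γ k).2
  obtain ⟨φ, hφ, hφx⟩ := exists_subseq_tendsto_or_norm_atTop Finset.univ x
  have : ∀ i, ∃ y, Tendsto (fun k => x (φ k) i) atTop (nhds y) ∨
      Tendsto (fun k => ‖x (φ k) i‖) atTop atTop := fun i =>
    (hφx i (Finset.mem_univ i)).elim (fun ⟨y, hy⟩ => ⟨y, Or.inl hy⟩) fun h => ⟨0, Or.inr h⟩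
  choose y hy using this
  set I := Finset.univ.filter fun i => Tendsto (fun k => x (φ k) i) atTop (nhds (y i))
  refine ⟨I.image y, Finset.card_image_le.trans ((Finset.card_le_univ I).trans (by simp)), ?_⟩
  have hle : ∀ ξ, dualQuantFpF p (I.image y) ξ ≤
      liminf (fun k => dualQuantFpF p (Γ (φ k) : Finset E) ξ) atTop := fun ξ => by
    refine le_of_forall_gt_imp_ge_of_dense fun c hc => ?_
    obtain ⟨ψ, hψ, hψc⟩ := extraction_of_frequently_atTop 
      (frequently_lt_of_liminf_lt (by isBoundedDefault) hc)
    refine dualQuantFpF_image_le_of_forall_lt (x := fun k => x (φ (ψ k)))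
      (Γ := fun k => Γ (φ (ψ k))) hp (fun i hi => ?_) (fun i hi => ?_) (fun k => hx _)
      tendsto_const_nhds hψc
    · exact (Finset.mem_filter.1 hi).2.comp hψ.tendsto_atTop
    · refine ((hy i).resolve_left fun h => hi ?_).comp hψ.tendsto_atTop
      exact Finset.mem_filter.2 ⟨Finset.mem_univ i, h⟩
  have hJ : Tendsto (fun k => ∫⁻ ξ, dualQuantFpF p (Γ (φ k) : Finset E) ξ ∂ν) atTop
      (nhds (dualQuantOpt p m ν ^ p)) := by
    have h1 : Tendsto (fun k => u (φ k) ^ p) atTop (nhds (dualQuantOpt p m ν ^ p)) :=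
      (ENNReal.continuous_rpow_const.tendsto _).comp (hu.comp hφ.tendsto_atTop)
    refine h1.congr fun k => ?_
    simp only [← hΓ, dualQuantErr, one_div, ENNReal.rpow_inv_rpow hp0]
  have hint : ∫⁻ ξ, dualQuantFpF p (I.image y) ξ ∂ν ≤ dualQuantOpt p m ν ^ p :=
    calc _ ≤ ∫⁻ ξ, liminf (fun k => dualQuantFpF p (Γ (φ k) : Finset E) ξ) atTop ∂ν :=
          lintegral_mono hle
      _ ≤ _ := lintegral_liminf_le fun k => measurable_dualQuantFpF hp _
      _ = _ := hJ.liminf_eq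
  rw [dualQuantErr, one_div, ENNReal.rpow_inv_le_iff (by linarith)]
  exact hint

lemma dualQuantErr_eq_zero_iff [SecondCountableTopology E] (hp : 1 < p) :
    dualQuantErr p ν Γ = 0 ↔ measSupport ν ⊆ Γ := by
  have hp0 : 0 < p := by linarith
  rw [dualQuantErr, ENNReal.rpow_eq_zero_iff_of_pos (by positivity),
    lintegral_eq_zero_iff (measurable_dualQuantFpF hp Γ), measSupport_eq_support]
  constructor
  · intro h
    refine Measure.support_subset_of_isClosed Γ.finite_toSet.isClosed ?_
    filter_upwards [h] with ξ hξ using (dualQuantFpF_eq_zero_iff hp0.ne').1 hξ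
  · intro h
    filter_upwards [Measure.support_mem_ae] with ξ hξ
    exact dualQuantFpF_of_mem hp0.ne' (h hξ)

/-- A grid with finite error which misses a point of the support can be strictly improved by
adding that point. -/
lemma dualQuantErr_insert_lt [DecidableEq E] (hp : 1 < p) (hfin : dualQuantErr p ν Γ ≠ ∞) {ξ₀ : E}
    (hξ₀ : ξ₀ ∈ measSupport ν) (h₀ : ξ₀ ∉ Γ) :
    dualQuantErr p ν (insert ξ₀ Γ) < dualQuantErr p ν Γ := by
  have hp0 : 0 < p := by linarith
  have hJ : ∫⁻ ξ, dualQuantFpF p Γ ξ ∂ν ≠ ∞ := fun h =>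
    hfin (by rw [dualQuantErr, h, ENNReal.top_rpow_of_pos (by positivity)])
  have hle : ∀ ξ, dualQuantFpF p (insert ξ₀ Γ) ξ ≤ dualQuantFpF p Γ ξ :=
    dualQuantFpF_mono (Finset.subset_insert _ _)
  refine ENNReal.rpow_lt_rpow ?_ (by positivity)
  refine lintegral_strict_mono_of_ae_le_of_ae_lt_on (measurable_dualQuantFpF hp Γ).aemeasurable
    (ne_top_of_le_ne_top hJ (lintegral_mono hle)) (Eventually.of_forall hle)
    (hξ₀ _ (eventually_dualQuantFpF_insert_lt hp0 h₀)).ne' ?_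
  filter_upwards [ae_lt_top (measurable_dualQuantFpF hp Γ) hJ] with ξ hξ hlt
  exact hlt hξ.ne

end Optimal

/-- Let `p ∈ (1,∞)`, `n ≥ d+1`, and `X` compactly supported with
`span(supp P_X) = ℝ^d`. If `|supp P_X| ≥ n`, any optimal grid at level `n` has exactly `n`
points; `d_{n,p}(X) = 0` iff `|supp P_X| ≤ n`; the sequence `m ↦ d_{m,p}(X)` is strictly
decreasing as long as it does not vanish, and tends to `0`. -/
theorem stmt15 {E : Type*} [NormedAddCommGroup E] [NormedSpace ℝ E]
    [FiniteDimensional ℝ E] [MeasurableSpace E] [BorelSpace E]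
    {Ω : Type*} [MeasurableSpace Ω] {μ : Measure Ω} [IsProbabilityMeasure μ]
    (X : Ω → E) (hX : Measurable X)
    (hcomp : IsCompact (measSupport (μ.map X)))
    (hspan : Submodule.span ℝ (measSupport (μ.map X)) = ⊤)
    (p : ℝ) (hp : 1 < p) (n : ℕ) (hn : Module.finrank ℝ E + 1 ≤ n) :
    (∀ Γ : Finset E, Γ.card ≤ n → dualQuantErr p (μ.map X) Γ = dualQuantOpt p n (μ.map X) →
      (n : ℕ∞) ≤ (measSupport (μ.map X)).encard → Γ.card = n) ∧
    (dualQuantOpt p n (μ.map X) = 0 ↔ (measSupport (μ.map X)).encard ≤ (n : ℕ∞)) ∧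
    (∀ m : ℕ, Module.finrank ℝ E + 1 ≤ m → 0 < dualQuantOpt p m (μ.map X) →
      dualQuantOpt p (m + 1) (μ.map X) < dualQuantOpt p m (μ.map X)) ∧
    Tendsto (fun m => dualQuantOpt p m (μ.map X)) atTop (nhds 0) := by
  classical
  have : ProperSpace E := FiniteDimensional.proper_real E
  have : IsProbabilityMeasure (μ.map X) := Measure.isProbabilityMeasure_map hX.aemeasurable
  refine ⟨fun Γ hΓ hopt hcard => ?_, ⟨fun h0 => ?_, fun hcard => ?_⟩, fun m hm hpos => ?_,
    tendsto_dualQuantOpt hp hcomp⟩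
  · refine hΓ.antisymm (not_lt.1 fun hlt => ?_)
    by_cases hsub : measSupport (μ.map X) ⊆ Γ
    · have := hcard.trans (encard_le_encard hsub)
      rw [encard_coe_eq_coe_finsetCard, Nat.cast_le] at this
      exact this.not_gt hlt
    · obtain ⟨ξ₀, hξ₀, h₀⟩ := not_subset.1 hsub
      have himp := dualQuantErr_insert_lt hp (hopt ▸ dualQuantOpt_ne_top hp hcomp hn) hξ₀ h₀
      rw [hopt] at himp
      exact himp.not_ge (dualQuantOpt_le ((Finset.card_insert_le _ _).trans hlt))
  · obtain ⟨Γ, hΓ, hle⟩ := exists_dualQuantErr_le_dualQuantOpt hp n (μ.map X)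
    have := encard_le_encard ((dualQuantErr_eq_zero_iff hp).1 (le_zero_iff.1 (hle.trans_eq h0)))
    rw [encard_coe_eq_coe_finsetCard] at this
    exact this.trans (Nat.cast_le.2 hΓ)
  · have hfin : (measSupport (μ.map X)).Finite := finite_of_encard_le_coe hcard
    refine le_zero_iff.1 ((dualQuantOpt_le (Γ := hfin.toFinset) ?_).trans_eq
      ((dualQuantErr_eq_zero_iff hp).2 (by simp)))
    rwa [hfin.encard_eq_coe_toFinset_card, Nat.cast_le] at hcard
  · obtain ⟨Γ, hΓ, hle⟩ := exists_dualQuantErr_le_dualQuantOpt hp m (μ.map X)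
    have hsub : ¬ measSupport (μ.map X) ⊆ Γ := fun h => hpos.not_ge
      ((dualQuantOpt_le hΓ).trans_eq ((dualQuantErr_eq_zero_iff hp).2 h))
    obtain ⟨ξ₀, hξ₀, h₀⟩ := not_subset.1 hsub
    have hfin := ne_top_of_le_ne_top (dualQuantOpt_ne_top hp hcomp hm) hle
    exact ((dualQuantOpt_le ((Finset.card_insert_le _ _).trans (by gcongr))).trans_lt
      (dualQuantErr_insert_lt hp hfin hξ₀ h₀)).trans_le hle
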